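/- arXiv:2111.14555 — 2 statements merged into one kernel-verified Lean document; each statement's English description precedes it below -/
import Mathlib

section
/- Let s* ∈ ℝ, let w*, w : ℝ → ℂ be continuous 2π-periodic functions, and let u* : ℝ → ℂ be a differentiable 2π-periodic solution of u*'(t) = w*(t) − i·s*·u*(t) − conj(w*(t))·u*(t)². Define Φ*(t) = exp(−∫₀^t (i·s* + 2·conj(w*(τ))·u*(τ)) dτ) and assume Φ*(2π) ≠ 1. If v : ℝ → ℂ is a differentiable 2π-periodic function satisfying the variational equation v'(t) = w(t) − (i·s* + 2·conj(w*(t))·u*(t))·v(t) − conj(w(t))·u*(t)² for all t, then v(t) = (𝒥(w − u*²·conj(w)))(t) for all t ∈ [0, 2π]. -/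
open Complex Real intervalIntegral

/-- The Heaviside step function: `Θ(r) = 0` for `r < 0` and `Θ(r) = 1` for `r ≥ 0`. -/
noncomputable def heaviside (r : ℝ) : ℝ := if r < 0 then 0 else 1

/-- Variation of constants: if `v' = f - a v` and `Φ = exp (-∫ a)`, then the increments of
`Φ⁻¹ v` are the integrals of `Φ⁻¹ f`. -/
theorem integral_inv_mul_eq_sub_of_linear_ode {a f v Φ : ℝ → ℂ}
    (ha : Continuous a) (hf : Continuous f)
    (hΦ : ∀ t : ℝ, Φ t = Complex.exp (-(∫ τ in (0:ℝ)..t, a τ)))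
    (hv : ∀ t : ℝ, HasDerivAt v (f t - a t * v t) t) (x y : ℝ) :
    ∫ τ in x..y, (Φ τ)⁻¹ * f τ = (Φ y)⁻¹ * v y - (Φ x)⁻¹ * v x := by
  have hinv : ∀ t, (Φ t)⁻¹ = Complex.exp (∫ τ in (0:ℝ)..t, a τ) := fun t => by
    rw [hΦ, ← Complex.exp_neg, neg_neg]
  have hderiv : ∀ t, HasDerivAt (fun s => (Φ s)⁻¹) ((Φ t)⁻¹ * a t) t := fun t => by
    simp only [hinv]
    exact (ha.integral_hasStrictDerivAt 0 t).hasDerivAt.cexp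
  have hcont : Continuous fun s => (Φ s)⁻¹ :=
    continuous_iff_continuousAt.2 fun t => (hderiv t).continuousAt
  refine integral_eq_sub_of_hasDerivAt (f := fun s => (Φ s)⁻¹ * v s) (fun t _ => ?_)
    ((hcont.mul hf).intervalIntegrable _ _)
  exact ((hderiv t).mul (hv t)).congr_deriv (by ring)

/-- A solution of `v' = f - a v` with `v T = v 0` is given by the Green function of the periodic
boundary value problem on `[0, T]`. -/
theorem eq_integral_green_of_linear_ode {a f v Φ : ℝ → ℂ} {T : ℝ}
    (ha : Continuous a) (hf : Continuous f)
    (hΦ : ∀ t : ℝ, Φ t = Complex.exp (-(∫ τ in (0:ℝ)..t, a τ))) (hΦT : Φ T ≠ 1)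
    (hvT : v T = v 0) (hv : ∀ t : ℝ, HasDerivAt v (f t - a t * v t) t)
    {t : ℝ} (ht : t ∈ Set.Icc 0 T) :
    v t = ∫ τ in (0:ℝ)..T,
      ((Φ T + (1 - Φ T) * ((heaviside (t - τ) : ℝ) : ℂ)) / (1 - Φ T)) * Φ t * (Φ τ)⁻¹ * f τ := by
  have hne : ∀ s, Φ s ≠ 0 := fun s => by rw [hΦ]; exact Complex.exp_ne_zero _
  have hΦ0 : Φ 0 = 1 := by simp [hΦ]
  have hsub : 1 - Φ T ≠ 0 := sub_ne_zero.2 hΦT.symm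
  have hcontΦ : Continuous Φ := by
    rw [funext hΦ]
    exact (continuous_primitive (fun _ _ => ha.intervalIntegrable _ _) 0).neg.cexp
  have hcont : Continuous fun τ => (Φ τ)⁻¹ * f τ := (hcontΦ.inv₀ hne).mul hf
  set k : ℝ → ℂ := fun τ =>
    ((Φ T + (1 - Φ T) * ((heaviside (t - τ) : ℝ) : ℂ)) / (1 - Φ T)) * Φ t * (Φ τ)⁻¹ * f τ
  have hleft : Set.EqOn (fun τ => Φ t / (1 - Φ T) * ((Φ τ)⁻¹ * f τ)) k (Set.uIoc 0 t) := by
    intro τ hτ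
    rw [Set.uIoc_of_le ht.1] at hτ
    have hstep : heaviside (t - τ) = 1 := if_neg (by linarith [hτ.2])
    simp only [k, hstep]
    push_cast
    ring
  have hright : Set.EqOn (fun τ => Φ T * Φ t / (1 - Φ T) * ((Φ τ)⁻¹ * f τ)) k
      (Set.uIoc t T) := by
    intro τ hτ
    rw [Set.uIoc_of_le ht.2] at hτ
    have hstep : heaviside (t - τ) = 0 := if_pos (by linarith [hτ.1])
    simp only [k, hstep]
    push_cast
    ring
  have hileft : IntervalIntegrable k MeasureTheory.volume 0 t :=
    ((continuous_const.mul hcont).intervalIntegrable _ _).congr hleft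
  have hiright : IntervalIntegrable k MeasureTheory.volume t T :=
    ((continuous_const.mul hcont).intervalIntegrable _ _).congr hright
  rw [← integral_add_adjacent_intervals hileft hiright,
    ← integral_congr_ae (.of_forall hleft), ← integral_congr_ae (.of_forall hright),
    integral_const_mul, integral_const_mul,
    integral_inv_mul_eq_sub_of_linear_ode ha hf hΦ hv,
    integral_inv_mul_eq_sub_of_linear_ode ha hf hΦ hv, hΦ0, hvT]
  have h1 := hne t
  have h2 := hne T
  field_simp
  ring

/-- (Derivative of `𝒰` with respect to `w`.) Let `u*` be a differentiable
`2π`-periodic solution of the Riccati equation `u*' = w* - i s* u* - conj(w*) u*²`, let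
`Φ*(t) = exp(-∫₀^t (i s* + 2 conj(w*) u*) dτ)` with `Φ*(2π) ≠ 1`. Then every differentiable
`2π`-periodic solution `v` of the variational equation
`v' = w - (i s* + 2 conj(w*) u*) v - conj(w) u*²` equals `𝒥(w - u*² conj(w))` on `[0, 2π]`. -/
theorem variational_solution_eq_green
    (sstar : ℝ) (wstar w : ℝ → ℂ)
    (hwstar : Continuous wstar) (hwstarper : ∀ t : ℝ, wstar (t + 2 * π) = wstar t)
    (hw : Continuous w) (hwper : ∀ t : ℝ, w (t + 2 * π) = w t)
    (ustar : ℝ → ℂ) (hustarper : ∀ t : ℝ, ustar (t + 2 * π) = ustar t)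
    (hustar : ∀ t : ℝ, HasDerivAt ustar
      (wstar t - Complex.I * (sstar : ℂ) * ustar t
        - (starRingEnd ℂ) (wstar t) * ustar t ^ 2) t)
    (Φ : ℝ → ℂ)
    (hΦ : ∀ t : ℝ, Φ t = Complex.exp (-(∫ τ in (0:ℝ)..t,
      (Complex.I * (sstar : ℂ) + 2 * (starRingEnd ℂ) (wstar τ) * ustar τ))))
    (hΦ1 : Φ (2 * π) ≠ 1)
    (v : ℝ → ℂ) (hvper : ∀ t : ℝ, v (t + 2 * π) = v t)
    (hv : ∀ t : ℝ, HasDerivAt v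
      (w t - (Complex.I * (sstar : ℂ) + 2 * (starRingEnd ℂ) (wstar t) * ustar t) * v t
        - (starRingEnd ℂ) (w t) * ustar t ^ 2) t) :
    ∀ t ∈ Set.Icc (0:ℝ) (2 * π),
      v t = ∫ τ in (0:ℝ)..(2 * π),
        ((Φ (2 * π) + (1 - Φ (2 * π)) * ((heaviside (t - τ) : ℝ) : ℂ)) / (1 - Φ (2 * π)))
          * Φ t * (Φ τ)⁻¹
          * (w τ - ustar τ ^ 2 * (starRingEnd ℂ) (w τ)) := by
  intro t ht
  have hconj : Continuous (starRingEnd ℂ) := Complex.continuous_conj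
  have hu : Continuous ustar :=
    continuous_iff_continuousAt.2 fun t => (hustar t).continuousAt
  have ha : Continuous fun τ =>
      Complex.I * (sstar : ℂ) + 2 * (starRingEnd ℂ) (wstar τ) * ustar τ :=
    continuous_const.add ((continuous_const.mul (hconj.comp hwstar)).mul hu)
  have hf : Continuous fun τ => w τ - ustar τ ^ 2 * (starRingEnd ℂ) (w τ) :=
    hw.sub ((hu.pow 2).mul (hconj.comp hw))
  refine eq_integral_green_of_linear_ode ha hf hΦ hΦ1 (by simpa using hvper 0) (fun s => ?_) ht
  exact (hv s).congr_deriv (by ring)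
end

section
/- Let s* ∈ ℝ, let w* : ℝ → ℂ be continuous and 2π-periodic, and let u* : ℝ → ℂ be a differentiable 2π-periodic solution of u*'(t) = w*(t) − i·s*·u*(t) − conj(w*(t))·u*(t)². Define Φ*(t) = exp(−∫₀^t (i·s* + 2·conj(w*(τ))·u*(τ)) dτ) and assume Φ*(2π) ≠ 1. If v : ℝ → ℂ is a differentiable 2π-periodic function satisfying v'(t) = −i·u*(t) − (i·s* + 2·conj(w*(t))·u*(t))·v(t) for all t, then v(t) = (𝒥(−i·u*))(t) for all t ∈ [0, 2π]. -/
open Complex Real intervalIntegral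

/-- The integral of a continuous function against a kernel that jumps at `t`. -/
theorem integral_heaviside_kernel_mul {g : ℝ → ℂ} (hg : Continuous g) (c d : ℂ) {t L : ℝ}
    (ht : t ∈ Set.Icc 0 L) :
    ∫ τ in (0:ℝ)..L, (c + d * (heaviside (t - τ) : ℂ)) * g τ
      = (c + d) * (∫ τ in (0:ℝ)..t, g τ) + c * ∫ τ in t..L, g τ := by
  have hleft : Set.EqOn (fun τ => (c + d) * g τ)
      (fun τ => (c + d * (heaviside (t - τ) : ℂ)) * g τ) (Set.uIoc 0 t) := by
    intro τ hτ
    rw [Set.uIoc_of_le ht.1] at hτ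
    simp [heaviside, not_lt.mpr hτ.2]
  have hright : Set.EqOn (fun τ => c * g τ)
      (fun τ => (c + d * (heaviside (t - τ) : ℂ)) * g τ) (Set.uIoc t L) := by
    intro τ hτ
    rw [Set.uIoc_of_le ht.2] at hτ
    simp [heaviside, hτ.1]
  have ileft := ((continuous_const.mul hg).intervalIntegrable (μ := MeasureTheory.volume) 0 t).congr
    hleft
  have iright := ((continuous_const.mul hg).intervalIntegrable (μ := MeasureTheory.volume) t L).congr
    hright
  rw [← integral_add_adjacent_intervals ileft iright, ← integral_const_mul, ← integral_const_mul]
  congr 1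
  · exact integral_congr_ae (.of_forall fun τ hτ => (hleft hτ).symm)
  · exact integral_congr_ae (.of_forall fun τ hτ => (hright hτ).symm)

/-- Variation of constants for `v' = f - a v`, with `Φ` the solution of `Φ' = -a Φ`, `Φ 0 = 1`. -/
theorem integral_inv_mul_eq_sub_of_hasDerivAt {a f v Φ : ℝ → ℂ} (ha : Continuous a)
    (hf : Continuous f) (hΦ : ∀ t, Φ t = Complex.exp (-∫ τ in (0:ℝ)..t, a τ))
    (hv : ∀ t, HasDerivAt v (f t - a t * v t) t) :
    Continuous (fun τ => (Φ τ)⁻¹ * f τ) ∧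
      ∀ x y, ∫ τ in x..y, (Φ τ)⁻¹ * f τ = (Φ y)⁻¹ * v y - (Φ x)⁻¹ * v x := by
  have hinv : ∀ t, (Φ t)⁻¹ = Complex.exp (∫ τ in (0:ℝ)..t, a τ) := fun t => by
    rw [hΦ, Complex.exp_neg, inv_inv]
  simp only [hinv]
  have hderiv : ∀ t, HasDerivAt (fun t => Complex.exp (∫ τ in (0:ℝ)..t, a τ))
      (Complex.exp (∫ τ in (0:ℝ)..t, a τ) * a t) t := fun t =>
    (ha.integral_hasStrictDerivAt 0 t).hasDerivAt.cexp
  have hcont : Continuous (fun t => Complex.exp (∫ τ in (0:ℝ)..t, a τ) * f t) :=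
    (continuous_iff_continuousAt.mpr fun t => (hderiv t).continuousAt).mul hf
  refine ⟨hcont, fun x y => integral_eq_sub_of_hasDerivAt (f := fun t =>
    Complex.exp (∫ τ in (0:ℝ)..t, a τ) * v t) (fun t _ => ?_) (hcont.intervalIntegrable x y)⟩
  exact ((hderiv t).mul (hv t)).congr_deriv (by ring)

/-- (Derivative of `𝒰` with respect to `s`.) Let `u*` be a differentiable
`2π`-periodic solution of the Riccati equation `u*' = w* - i s* u* - conj(w*) u*²`, let
`Φ*(t) = exp(-∫₀^t (i s* + 2 conj(w*) u*) dτ)` with `Φ*(2π) ≠ 1`. Then every differentiable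
`2π`-periodic solution `v` of `v' = -i u* - (i s* + 2 conj(w*) u*) v`
equals `𝒥(-i u*)` on `[0, 2π]`. -/
theorem variational_solution_s_eq_green
    (sstar : ℝ) (wstar : ℝ → ℂ)
    (hwstar : Continuous wstar) (hwstarper : ∀ t : ℝ, wstar (t + 2 * π) = wstar t)
    (ustar : ℝ → ℂ) (hustarper : ∀ t : ℝ, ustar (t + 2 * π) = ustar t)
    (hustar : ∀ t : ℝ, HasDerivAt ustar
      (wstar t - Complex.I * (sstar : ℂ) * ustar t
        - (starRingEnd ℂ) (wstar t) * ustar t ^ 2) t)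
    (Φ : ℝ → ℂ)
    (hΦ : ∀ t : ℝ, Φ t = Complex.exp (-(∫ τ in (0:ℝ)..t,
      (Complex.I * (sstar : ℂ) + 2 * (starRingEnd ℂ) (wstar τ) * ustar τ))))
    (hΦ1 : Φ (2 * π) ≠ 1)
    (v : ℝ → ℂ) (hvper : ∀ t : ℝ, v (t + 2 * π) = v t)
    (hv : ∀ t : ℝ, HasDerivAt v
      (-Complex.I * ustar t
        - (Complex.I * (sstar : ℂ) + 2 * (starRingEnd ℂ) (wstar t) * ustar t) * v t) t) :
    ∀ t ∈ Set.Icc (0:ℝ) (2 * π),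
      v t = ∫ τ in (0:ℝ)..(2 * π),
        ((Φ (2 * π) + (1 - Φ (2 * π)) * ((heaviside (t - τ) : ℝ) : ℂ)) / (1 - Φ (2 * π)))
          * Φ t * (Φ τ)⁻¹ * (-Complex.I * ustar τ) := by
  intro t ht
  have hu : Continuous ustar := continuous_iff_continuousAt.mpr fun t => (hustar t).continuousAt
  obtain ⟨hcont, hint⟩ := integral_inv_mul_eq_sub_of_hasDerivAt
    (a := fun τ => Complex.I * (sstar : ℂ) + 2 * (starRingEnd ℂ) (wstar τ) * ustar τ)
    (f := fun τ => -Complex.I * ustar τ)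
    (continuous_const.add ((continuous_const.mul (Complex.continuous_conj.comp hwstar)).mul hu))
    (continuous_const.mul hu) hΦ hv
  have hkernel := integral_heaviside_kernel_mul hcont (Φ (2 * π)) (1 - Φ (2 * π)) ht
  rw [hint, hint] at hkernel
  have hΦ0 : Φ 0 = 1 := by simp [hΦ]
  have hv0 : v (2 * π) = v 0 := by simpa using hvper 0
  have hne : ∀ s, Φ s ≠ 0 := fun s => by rw [hΦ]; exact Complex.exp_ne_zero _
  have hsub : 1 - Φ (2 * π) ≠ 0 := sub_ne_zero.mpr hΦ1.symm
  have hfactor : ∀ τ, ((Φ (2 * π) + (1 - Φ (2 * π)) * ((heaviside (t - τ) : ℝ) : ℂ))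
      / (1 - Φ (2 * π))) * Φ t * (Φ τ)⁻¹ * (-Complex.I * ustar τ)
      = (Φ t / (1 - Φ (2 * π))) * ((Φ (2 * π) + (1 - Φ (2 * π)) * (heaviside (t - τ) : ℂ))
        * ((Φ τ)⁻¹ * (-Complex.I * ustar τ))) := fun τ => by ring
  simp only [hfactor]
  rw [integral_const_mul, hkernel, hΦ0, hv0]
  have h1 := hne t
  have h2 := hne (2 * π)
  field_simp
  ring
end
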